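/- arXiv:1908.01327 — 2 statements merged into one kernel-verified Lean document; each statement's English description precedes it below -/
import Mathlib

section
/- Explicit O(1/n) rate for the relaxed block Jacobi method: under the equal-size M_s × N_s rectangular decomposition with color classes S_1,…,S_{N_c}, let p⁽⁰⁾ ∈ C and p⁽ⁿ⁺¹⁾ = (1/N_c) Σ_{k=1}^{N_c} S̄_k(p⁽ⁿ⁾), where S̄_k(q) = R_k* s_k + (I − R_k* R_k) q with s_k ∈ C_k any minimizer of F_k(·; q) over C_k, and let p* be a minimizer of F over C. Then for any n ≥ 1, F(p⁽ⁿ⁾) − F(p*) ≤ (N_c/n)[(2 − 1/N_c)(F(p⁽⁰⁾) − F(p*)) + 2c₁], where c₁ = 7(M N_s + M_s N − (11/7) M_s N_s). -/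
open Finset

noncomputable section

/-- The discrete image domain of `M × N` pixels. -/
abbrev Idx (M N : ℕ) := Fin M × Fin N

/-- The discrete divergence operator `div : W → V`, the negative adjoint of
the discrete gradient. -/
def divOp {M N : ℕ} (p : Idx M N → ℝ × ℝ) : Idx M N → ℝ := fun x =>
  ((if (x.1 : ℕ) + 1 < M then (p x).1 else 0)
    - (if 1 ≤ (x.1 : ℕ) then
        (p (⟨(x.1 : ℕ) - 1, lt_of_le_of_lt (Nat.sub_le _ _) x.1.isLt⟩, x.2)).1 else 0))
  + ((if (x.2 : ℕ) + 1 < N then (p x).2 else 0)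
    - (if 1 ≤ (x.2 : ℕ) then
        (p (x.1, ⟨(x.2 : ℕ) - 1, lt_of_le_of_lt (Nat.sub_le _ _) x.2.isLt⟩)).2 else 0))

/-- The discrete gradient operator `∇ : V → W`. -/
def gradOp {M N : ℕ} (u : Idx M N → ℝ) : Idx M N → ℝ × ℝ := fun x =>
  ((if h : (x.1 : ℕ) + 1 < M then u (⟨(x.1 : ℕ) + 1, h⟩, x.2) - u x else 0),
   (if h : (x.2 : ℕ) + 1 < N then u (x.1, ⟨(x.2 : ℕ) + 1, h⟩) - u x else 0))

/-- Euclidean inner product on `V`. -/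
def innerV {M N : ℕ} (u v : Idx M N → ℝ) : ℝ := ∑ x, u x * v x

/-- Euclidean inner product on `W`. -/
def innerW {M N : ℕ} (p q : Idx M N → ℝ × ℝ) : ℝ :=
  ∑ x, ((p x).1 * (q x).1 + (p x).2 * (q x).2)

/-- Squared Euclidean norm on `V`. -/
def normVsq {M N : ℕ} (u : Idx M N → ℝ) : ℝ := ∑ x, (u x) ^ 2

/-- Max (Euclidean-pointwise) norm on `W`. -/
def normWinf {M N : ℕ} (p : Idx M N → ℝ × ℝ) : ℝ :=
  ⨆ x : Idx M N, Real.sqrt ((p x).1 ^ 2 + (p x).2 ^ 2)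

/-- The dual ROF energy `F(p) = (1/2)‖div p + α f‖₂²`. -/
def F {M N : ℕ} (α : ℝ) (f : Idx M N → ℝ) (p : Idx M N → ℝ × ℝ) : ℝ :=
  (1 / 2) * normVsq (fun x => divOp p x + α * f x)

/-- The gradient of `F`, namely `∇F(q) = div*(div q + α f) = -∇(div q + α f)`. -/
def gradF {M N : ℕ} (α : ℝ) (f : Idx M N → ℝ) (q : Idx M N → ℝ × ℝ) :
    Idx M N → ℝ × ℝ :=
  fun x => - gradOp (fun y => divOp q y + α * f y) x

/-- The constraint set `C = {p ∈ W : |p_{ij}| ≤ 1 ∀ (i,j)}`. -/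
def Cset (M N : ℕ) : Set (Idx M N → ℝ × ℝ) :=
  {p | ∀ x, Real.sqrt ((p x).1 ^ 2 + (p x).2 ^ 2) ≤ 1}

/-- Restriction operator `R_k : W → W_k`. -/
def Rk {M N : ℕ} (S : Finset (Idx M N)) (p : Idx M N → ℝ × ℝ) :
    {x // x ∈ S} → ℝ × ℝ :=
  fun x => p x.1

/-- Extension-by-zero operator `R_k* : W_k → W`. -/
def Ek {M N : ℕ} (S : Finset (Idx M N)) (pk : {x // x ∈ S} → ℝ × ℝ) :
    Idx M N → ℝ × ℝ :=
  fun x => if h : x ∈ S then pk ⟨x, h⟩ else 0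

/-- The orthogonal projection `R_k* R_k : W → W`. -/
def projk {M N : ℕ} (S : Finset (Idx M N)) (p : Idx M N → ℝ × ℝ) :
    Idx M N → ℝ × ℝ :=
  fun x => if x ∈ S then p x else 0

/-- The local constraint set `C_k = R_k C`. -/
def Ck {M N : ℕ} (S : Finset (Idx M N)) : Set ({x // x ∈ S} → ℝ × ℝ) :=
  Rk S '' Cset M N

/-- The local energy `F_k(p_k; r) = F(R_k* p_k + (I - R_k* R_k) r)`. -/
def Fk {M N : ℕ} (α : ℝ) (f : Idx M N → ℝ) (S : Finset (Idx M N))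
    (pk : {x // x ∈ S} → ℝ × ℝ) (r : Idx M N → ℝ × ℝ) : ℝ :=
  F α f (Ek S pk + (r - projk S r))

/-- Euclidean inner product on `W_k`. -/
def innerWk {M N : ℕ} (S : Finset (Idx M N)) (pk qk : {x // x ∈ S} → ℝ × ℝ) : ℝ :=
  ∑ x : {x // x ∈ S}, ((pk x).1 * (qk x).1 + (pk x).2 * (qk x).2)

/-- The distance-like quantity `D(p,q) = Σ_k (1/2)‖div R_k* R_k (p - q)‖₂²`. -/
def Ddist {M N Nc : ℕ} (S : Fin Nc → Finset (Idx M N))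
    (p q : Idx M N → ℝ × ℝ) : ℝ :=
  ∑ k, (1 / 2) * normVsq (divOp (projk (S k) (p - q)))

/-- The rectangular subdomain `Ω_s` of size `m × n` indexed by `s : Fin Ms × Fin Ns`
(for an `M × N` image with `M = Ms * m`, `N = Ns * n`). -/
def block {M N Ms Ns : ℕ} (m n : ℕ) (s : Fin Ms × Fin Ns) : Finset (Idx M N) :=
  Finset.univ.filter fun x => (x.1 : ℕ) / m = (s.1 : ℕ) ∧ (x.2 : ℕ) / n = (s.2 : ℕ)

end

theorem fourth_power_mul_le_of_descent {a z z' X X' V : ℝ} (ha : 0 < a) (ha1 : a ≤ 1)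
    (hz' : 0 ≤ z') (hX : 0 ≤ X) (hX' : 0 ≤ X') (hV : 0 ≤ V)
    (hsum : X' + z' ≤ X + z - a * z) (hdec : z' ≤ z - a * V)
    (hdist : (√X - a * √V) ^ 2 ≤ X') :
    z' ^ 4 * (X + z) ≤ z ^ 4 * (X' + z') := by
  have haV : 0 ≤ a * V := by positivity
  have hzz : z' ≤ z := by linarith
  have hz : 0 ≤ z := hz'.trans hzz
  obtain ⟨s, hs⟩ : ∃ s, s = √((z - z') / a) := ⟨_, rfl⟩
  have hs0 : 0 ≤ s := hs ▸ Real.sqrt_nonneg _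
  have hs2 : z' = z - a * s ^ 2 := by
    rw [hs, Real.sq_sqrt (div_nonneg (by linarith) ha.le)]
    field_simp
    ring
  have hVs : √V ≤ s := by
    rw [hs]
    apply Real.sqrt_le_sqrt
    rw [le_div_iff₀ ha]
    linarith
  obtain ⟨r, hr⟩ : ∃ r, r = √X := ⟨_, rfl⟩
  have hr0 : 0 ≤ r := hr ▸ Real.sqrt_nonneg _
  have hr2 : X = r ^ 2 := by rw [hr, Real.sq_sqrt hX]
  rw [← hr] at hdist
  have hcube : z' ^ 3 * (z + 3 * (a * s ^ 2)) ≤ z ^ 4 := by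
    have hd : 0 ≤ a * s ^ 2 := by positivity
    obtain ⟨d, hd'⟩ : ∃ d, d = a * s ^ 2 := ⟨_, rfl⟩
    rw [← hd'] at hd hs2 ⊢
    have : z = z' + d := by linarith
    rw [this]
    have h1 : 0 ≤ 6 * z' ^ 2 * d ^ 2 + 4 * z' * d ^ 3 + d ^ 4 := by positivity
    nlinarith
  rcases le_total (a * s) r with has | has
  · have hX's : (r - a * s) ^ 2 ≤ X' := by
      refine le_trans ?_ hdist
      have := mul_le_mul_of_nonneg_left hVs ha.le
      exact pow_le_pow_left₀ (by linarith) (by linarith) 2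
    have hzl : z ≤ 2 * r * s + (1 - a) * s ^ 2 := by
      have : a * z ≤ a * (2 * r * s + (1 - a) * s ^ 2) := by nlinarith
      exact le_of_mul_le_mul_left this ha
    have hquad : 0 ≤ 4 * s ^ 2 * (r ^ 2 + z)
        - (2 * r * s + (1 - a) * s ^ 2) * (z + 3 * (a * s ^ 2)) := by
      rcases le_total (2 * r * s + (1 - a) * s ^ 2) (4 * s ^ 2) with h | h
      · have h1 : 0 ≤ (z - a * s ^ 2) * (4 * s ^ 2 - (2 * r * s + (1 - a) * s ^ 2)) :=
          mul_nonneg (by linarith) (by linarith)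
        have h2 : 0 ≤ 4 * s ^ 2 * (r - a * s) ^ 2 := by positivity
        nlinarith
      · have h1 : 0 ≤ (2 * r * s + (1 - a) * s ^ 2 - z)
            * (2 * r * s + (1 - a) * s ^ 2 - 4 * s ^ 2) :=
          mul_nonneg (by linarith) (by linarith)
        have h2 : 0 ≤ s ^ 3 * (r * (4 - 2 * a) + (1 - a) * (3 - 2 * a) * s) := by
          have h3 : 0 ≤ 4 - 2 * a := by linarith
          have h4 : 0 ≤ 3 - 2 * a := by linarith
          have h5 : 0 ≤ 1 - a := by linarith
          positivity
        nlinarith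
    have hlin : z' * (X + z) ≤ (z + 3 * (a * s ^ 2)) * (X' + z') := by
      have h1 : (z + 3 * (a * s ^ 2)) * ((r - a * s) ^ 2 + z')
          ≤ (z + 3 * (a * s ^ 2)) * (X' + z') :=
        mul_le_mul_of_nonneg_left (by linarith) (by positivity)
      refine le_trans ?_ h1
      have h2 := mul_nonneg ha.le hquad
      rw [hs2, hr2]
      nlinarith
    calc z' ^ 4 * (X + z) = z' ^ 3 * (z' * (X + z)) := by ring
      _ ≤ z' ^ 3 * ((z + 3 * (a * s ^ 2)) * (X' + z')) := by gcongr
      _ = z' ^ 3 * (z + 3 * (a * s ^ 2)) * (X' + z') := by ring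
      _ ≤ z ^ 4 * (X' + z') := by gcongr
  · have hrd : r ^ 2 ≤ a * s ^ 2 := by
      calc r ^ 2 ≤ (a * s) ^ 2 := by gcongr
        _ = a * (a * s ^ 2) := by ring
        _ ≤ 1 * (a * s ^ 2) := by gcongr
        _ = a * s ^ 2 := one_mul _
    have hlin : z' * (X + z) ≤ z ^ 2 := by
      rw [hr2]
      calc z' * (r ^ 2 + z) ≤ z' * (a * s ^ 2 + z) := by gcongr
        _ = z ^ 2 - (a * s ^ 2) ^ 2 := by rw [hs2]; ring
        _ ≤ z ^ 2 := by linarith [sq_nonneg (a * s ^ 2)]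
    calc z' ^ 4 * (X + z) = z' ^ 2 * z' * (z' * (X + z)) := by ring
      _ ≤ z ^ 2 * z' * z ^ 2 := by gcongr
      _ = z ^ 4 * z' := by ring
      _ ≤ z ^ 4 * (X' + z') := by gcongr; linarith

theorem mul_le_three_quarters_of_descent {a : ℝ} (ha : 0 < a) (ha1 : a ≤ 1) (z X V : ℕ → ℝ)
    (hz : ∀ i, 0 ≤ z i) (hX : ∀ i, 0 ≤ X i) (hV : ∀ i, 0 ≤ V i)
    (hsum : ∀ i, X (i + 1) + z (i + 1) ≤ X i + z i - a * z i)
    (hdec : ∀ i, z (i + 1) ≤ z i - a * V i)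
    (hdist : ∀ i, (√(X i) - a * √(V i)) ^ 2 ≤ X (i + 1)) (K : ℕ) :
    a * K * z K ≤ 3 / 4 * (X 0 + z 0) := by
  obtain ⟨y, hy⟩ : ∃ y : ℕ → ℝ, ∀ i, y i = √√(X i + z i) := ⟨_, fun _ => rfl⟩
  have hy0 : ∀ i, 0 ≤ y i := fun i => hy i ▸ Real.sqrt_nonneg _
  have hXz : ∀ i, 0 ≤ X i + z i := fun i => add_nonneg (hX i) (hz i)
  have hy4 : ∀ i, X i + z i = y i ^ 4 := fun i => by
    rw [hy, show 4 = 2 * 2 from rfl, pow_mul, Real.sq_sqrt (Real.sqrt_nonneg _),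
      Real.sq_sqrt (hXz i)]
  have hdecr : ∀ i, z (i + 1) ≤ z i := fun i => by
    have := mul_nonneg ha.le (hV i)
    linarith [hdec i]
  have hstep : ∀ i, z (i + 1) * y i ≤ z i * y (i + 1) := fun i => by
    have h := fourth_power_mul_le_of_descent ha ha1 (hz (i + 1)) (hX i) (hX (i + 1)) (hV i)
      (hsum i) (hdec i) (hdist i)
    rw [hy4, hy4, ← mul_pow, ← mul_pow] at h
    exact le_of_pow_le_pow_left₀ (by norm_num) (mul_nonneg (hz i) (hy0 _)) h
  rcases (hz K).eq_or_lt with hK | hK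
  · rw [← hK, mul_zero]
    linarith [hXz 0]
  have hzpos : ∀ i, i ≤ K → 0 < z i := fun i hi =>
    hK.trans_le (antitone_nat_of_succ_le hdecr hi)
  have hypos : ∀ i, i ≤ K → 0 < y i := fun i hi => by
    rcases (hy0 i).eq_or_lt with h | h
    · have := hy4 i
      rw [← h] at this
      linarith [hzpos i hi, hX i]
    · exact h
  have hratio : ∀ j, j ≤ K → z K * y (K - j) ≤ z (K - j) * y K := by
    intro j
    induction j with
    | zero => intro _; simp
    | succ j ih =>
      intro hj
      obtain ⟨i, hi⟩ : ∃ i, i = K - (j + 1) := ⟨_, rfl⟩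
      have hi' : K - j = i + 1 := by omega
      have h1 := ih (by omega)
      rw [hi'] at h1
      rw [← hi]
      have h2 := hstep i
      have hp := hypos (i + 1) (by omega)
      have h3 : (z K * y i) * y (i + 1) ≤ (z i * y K) * y (i + 1) := by
        calc (z K * y i) * y (i + 1) = (z K * y (i + 1)) * y i := by ring
          _ ≤ (z (i + 1) * y K) * y i := by gcongr; exact hy0 i
          _ = (z (i + 1) * y i) * y K := by ring
          _ ≤ (z i * y (i + 1)) * y K := by gcongr; exact hy0 K
          _ = (z i * y K) * y (i + 1) := by ring
      exact le_of_mul_le_mul_right h3 hp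
  have hcube : ∀ i, i < K → 3 / 4 * (a * z K) ≤ y K * (y i ^ 3 - y (i + 1) ^ 3) := by
    intro i hi
    have h1 := hratio (K - i) (by omega)
    rw [show K - (K - i) = i by omega] at h1
    have h2 := hsum i
    rw [hy4, hy4] at h2
    have hp := hypos i hi.le
    have h3 : 0 ≤ (y i - y (i + 1)) ^ 2 * (y i ^ 2 + 2 * y i * y (i + 1) + 3 * y (i + 1) ^ 2) := by
      have := hy0 (i + 1)
      positivity
    have h4 : a * z i ≤ 4 / 3 * (y i * (y i ^ 3 - y (i + 1) ^ 3)) := by nlinarith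
    have h5 : (3 / 4 * (a * z K)) * y i ≤ (y K * (y i ^ 3 - y (i + 1) ^ 3)) * y i := by
      have h6 := mul_le_mul_of_nonneg_left h1 ha.le
      have h7 := mul_le_mul_of_nonneg_left h4 (hy0 K)
      linarith
    exact le_of_mul_le_mul_right h5 hp
  have htel : ∀ j, j ≤ K → j * (3 / 4 * (a * z K)) ≤ y K * (y 0 ^ 3 - y j ^ 3) := by
    intro j
    induction j with
    | zero => intro _; simp
    | succ j ih =>
      intro hj
      have h1 := ih (by omega)
      have h2 := hcube j (by omega)
      push_cast
      linarith
  have h := htel K le_rfl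
  have hpoly : y K * (y 0 ^ 3 - y K ^ 3) ≤ 9 / 16 * y 0 ^ 4 := by
    have h0 := hy0 0
    have hK := hy0 K
    nlinarith [sq_nonneg (y K ^ 2 - 3 / 8 * y 0 ^ 2), sq_nonneg (y K - 2 / 3 * y 0),
      mul_nonneg (sq_nonneg (y 0)) (sq_nonneg (y K - 2 / 3 * y 0))]
  rw [hy4]
  linarith

theorem norm_sum_sq_le_card_mul {H ι : Type*} [SeminormedAddCommGroup H] [Fintype ι]
    (v : ι → H) :
    ‖∑ k, v k‖ ^ 2 ≤ Fintype.card ι * ∑ k, ‖v k‖ ^ 2 :=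
  calc ‖∑ k, v k‖ ^ 2 ≤ (∑ k, ‖v k‖) ^ 2 := by
        gcongr
        exact norm_sum_le _ _
    _ ≤ Fintype.card ι * ∑ k, ‖v k‖ ^ 2 := sq_sum_le_card_mul_sum_sq

section Abstract

variable {H ι : Type*} [NormedAddCommGroup H] [InnerProductSpace ℝ H] [Fintype ι]

theorem half_norm_add_smul_sq (h w : H) (a : ℝ) :
    1 / 2 * ‖h + a • w‖ ^ 2
      = 1 / 2 * ‖h‖ ^ 2 + a * inner ℝ h w + 1 / 2 * a ^ 2 * ‖w‖ ^ 2 := by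
  rw [norm_add_sq_real, inner_smul_right, norm_smul, mul_pow, Real.norm_eq_abs, sq_abs]
  ring

theorem half_norm_sq_relaxed_step_le {a : ℝ} (ha : 0 ≤ a) (hcard : a * Fintype.card ι ≤ 1)
    (h : H) (v : ι → H) (hv : ∀ k, inner ℝ (h + v k) (v k) ≤ 0) :
    1 / 2 * ‖h + a • ∑ k, v k‖ ^ 2
      ≤ 1 / 2 * ‖h‖ ^ 2 - a * (1 / 2 * ∑ k, ‖v k‖ ^ 2) := by
  have h1 : inner ℝ h (∑ k, v k) ≤ - ∑ k, ‖v k‖ ^ 2 := by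
    rw [inner_sum, ← Finset.sum_neg_distrib]
    refine Finset.sum_le_sum fun k _ => ?_
    have := hv k
    rw [inner_add_left, real_inner_self_eq_norm_sq] at this
    linarith
  have h0 : 0 ≤ ∑ k, ‖v k‖ ^ 2 := by positivity
  have h2 : a * ‖∑ k, v k‖ ^ 2 ≤ ∑ k, ‖v k‖ ^ 2 := by
    have := mul_le_mul_of_nonneg_left (norm_sum_sq_le_card_mul v) ha
    nlinarith [mul_le_mul_of_nonneg_right hcard h0]
  rw [half_norm_add_smul_sq]
  nlinarith [mul_le_mul_of_nonneg_left h1 ha, mul_le_mul_of_nonneg_left h2 ha]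

theorem sum_norm_add_smul_sq (e v : ι → H) (a : ℝ) :
    1 / 2 * ∑ k, ‖e k + a • v k‖ ^ 2 = 1 / 2 * ∑ k, ‖e k‖ ^ 2
      + a * ∑ k, inner ℝ (e k) (v k) + a ^ 2 * (1 / 2 * ∑ k, ‖v k‖ ^ 2) := by
  simp only [Finset.mul_sum, ← Finset.sum_add_distrib, half_norm_add_smul_sq]
  exact Finset.sum_congr rfl fun k _ => by ring

theorem relaxed_step_distance_add_energy_le {a : ℝ} (ha : 0 ≤ a) (ha1 : a ≤ 1)
    (hcard : a * Fintype.card ι ≤ 1) (h : H) (e v : ι → H)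
    (hv : ∀ k, inner ℝ (h + v k) (e k + v k) ≤ 0) :
    1 / 2 * ∑ k, ‖e k + a • v k‖ ^ 2
        + (1 / 2 * ‖h + a • ∑ k, v k‖ ^ 2 - 1 / 2 * ‖h - ∑ k, e k‖ ^ 2)
      ≤ 1 / 2 * ∑ k, ‖e k‖ ^ 2 + (1 / 2 * ‖h‖ ^ 2 - 1 / 2 * ‖h - ∑ k, e k‖ ^ 2)
        - a * (1 / 2 * ‖h‖ ^ 2 - 1 / 2 * ‖h - ∑ k, e k‖ ^ 2) := by
  have h1 : inner ℝ h (∑ k, e k) + inner ℝ h (∑ k, v k) + ∑ k, inner ℝ (e k) (v k)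
      + ∑ k, ‖v k‖ ^ 2 ≤ 0 := by
    rw [inner_sum, inner_sum, ← Finset.sum_add_distrib, ← Finset.sum_add_distrib,
      ← Finset.sum_add_distrib]
    refine Finset.sum_nonpos fun k _ => ?_
    have := hv k
    rw [inner_add_left, inner_add_right, inner_add_right, real_inner_self_eq_norm_sq,
      real_inner_comm (e k) (v k)] at this
    linarith
  have h0 : 0 ≤ ∑ k, ‖v k‖ ^ 2 := by positivity
  have h2 : a * ‖∑ k, v k‖ ^ 2 ≤ ∑ k, ‖v k‖ ^ 2 := by
    have := mul_le_mul_of_nonneg_left (norm_sum_sq_le_card_mul v) ha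
    nlinarith [mul_le_mul_of_nonneg_right hcard h0]
  rw [half_norm_add_smul_sq, sum_norm_add_smul_sq]
  have h3 := norm_sub_sq_real h (∑ k, e k)
  have h4 := mul_le_mul_of_nonneg_left h1 ha
  have h5 := mul_le_mul_of_nonneg_left h2 ha
  have h6 : 0 ≤ a * (1 - a) * ∑ k, ‖v k‖ ^ 2 :=
    mul_nonneg (mul_nonneg ha (sub_nonneg.2 ha1)) h0
  have h7 : 0 ≤ a * ‖∑ k, e k‖ ^ 2 := by positivity
  nlinarith

theorem sq_sqrt_sub_le_relaxed_step_distance {a : ℝ} (ha : 0 ≤ a) (e v : ι → H) :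
    (√(1 / 2 * ∑ k, ‖e k‖ ^ 2) - a * √(1 / 2 * ∑ k, ‖v k‖ ^ 2)) ^ 2
      ≤ 1 / 2 * ∑ k, ‖e k + a • v k‖ ^ 2 := by
  have hcs : (∑ k, ‖e k‖ * ‖v k‖) ≤ √(∑ k, ‖e k‖ ^ 2) * √(∑ k, ‖v k‖ ^ 2) :=
    Real.sum_mul_le_sqrt_mul_sqrt _ _ _
  have hin : -(∑ k, ‖e k‖ * ‖v k‖) ≤ ∑ k, inner ℝ (e k) (v k) := by
    rw [← Finset.sum_neg_distrib]
    exact Finset.sum_le_sum fun k _ => (abs_le.1 (abs_real_inner_le_norm _ _)).1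
  have hhalf : √(1 / 2 : ℝ) ^ 2 = 1 / 2 := Real.sq_sqrt (by norm_num)
  have hE : √(∑ k, ‖e k‖ ^ 2) ^ 2 = ∑ k, ‖e k‖ ^ 2 := Real.sq_sqrt (by positivity)
  have hV : √(∑ k, ‖v k‖ ^ 2) ^ 2 = ∑ k, ‖v k‖ ^ 2 := Real.sq_sqrt (by positivity)
  rw [sum_norm_add_smul_sq, Real.sqrt_mul (by norm_num), Real.sqrt_mul (by norm_num)]
  have h1 := mul_le_mul_of_nonneg_left (hin.trans' (neg_le_neg hcs)) ha
  calc (√(1 / 2) * √(∑ k, ‖e k‖ ^ 2) - a * (√(1 / 2) * √(∑ k, ‖v k‖ ^ 2))) ^ 2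
      = √(1 / 2) ^ 2 * (√(∑ k, ‖e k‖ ^ 2) ^ 2
          + 2 * (a * -(√(∑ k, ‖e k‖ ^ 2) * √(∑ k, ‖v k‖ ^ 2)))
          + a ^ 2 * √(∑ k, ‖v k‖ ^ 2) ^ 2) := by ring
    _ ≤ _ := by rw [hhalf, hE, hV]; linarith

theorem nonneg_of_forall_mul_add_sq_nonneg {b c : ℝ} (hc : 0 ≤ c)
    (h : ∀ t : ℝ, 0 ≤ t → t ≤ 1 → 0 ≤ t * b + t ^ 2 * c) : 0 ≤ b := by
  by_contra! hb
  have hpos : 0 < c - b := by linarith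
  have h1 := h (-b / (c - b)) (div_nonneg (by linarith) hpos.le)
    ((div_le_one hpos).2 (by linarith))
  have h2 : -b / (c - b) * b + (-b / (c - b)) ^ 2 * c = b ^ 3 / (c - b) ^ 2 := by
    field_simp
    ring
  rw [h2] at h1
  have h3 : b ^ 3 / (c - b) ^ 2 < 0 :=
    div_neg_of_neg_of_pos (Odd.pow_neg (by decide) hb) (by positivity)
  linarith

theorem inner_nonneg_of_isMinOn_half_norm_sq {W : Type*} [AddCommGroup W] [Module ℝ W]
    {K : Set W} (hK : Convex ℝ K) (L : W →ₗ[ℝ] H) (c : H) {q z : W} (hq : q ∈ K) (hz : z ∈ K)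
    (hmin : ∀ r ∈ K, 1 / 2 * ‖L q + c‖ ^ 2 ≤ 1 / 2 * ‖L r + c‖ ^ 2) :
    0 ≤ inner ℝ (L q + c) (L (z - q)) := by
  refine nonneg_of_forall_mul_add_sq_nonneg (c := 1 / 2 * ‖L (z - q)‖ ^ 2) (by positivity)
    fun t ht ht1 => ?_
  have h1 := hmin _ (hK.add_smul_sub_mem hq hz ⟨ht, ht1⟩)
  rw [map_add, map_smul, add_right_comm, half_norm_add_smul_sq] at h1
  linarith

end Abstract

theorem sum_sq_colored_le {ι : Type*} [Fintype ι] [DecidableEq ι] (i j l : ι) (u b e : ℝ) :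
    ∑ k, ((if i = k then u else 0) - (if j = k then b else 0) - (if l = k then e else 0)) ^ 2
      ≤ (u - b - e) ^ 2 + (u ^ 2 + 2 * b ^ 2 + 2 * e ^ 2) := by
  have hexp : ∀ k, ((if i = k then u else 0) - (if j = k then b else 0)
      - (if l = k then e else 0)) ^ 2
      = (if i = k then u ^ 2 else 0) + (if j = k then b ^ 2 else 0) + (if l = k then e ^ 2 else 0)
        - (if i = k then (if i = j then 2 * u * b else 0) else 0)
        - (if i = k then (if i = l then 2 * u * e else 0) else 0)
        + (if j = k then (if j = l then 2 * b * e else 0) else 0) := by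
    intro k
    by_cases hi : i = k <;> by_cases hj : j = k <;> by_cases hl : l = k <;>
      simp [hi, hj, hl, eq_comm] <;> ring
  simp only [hexp, Finset.sum_add_distrib, Finset.sum_sub_distrib, Finset.sum_ite_eq,
    Finset.mem_univ, if_true]
  split_ifs <;>
    nlinarith [sq_nonneg (u - b - e), sq_nonneg (u - b), sq_nonneg (u - e), sq_nonneg (b - e),
      sq_nonneg (u + b), sq_nonneg (u + e), sq_nonneg (b + e), sq_nonneg u, sq_nonneg b,
      sq_nonneg e]

theorem sum_sq_single_color {ι : Type*} [Fintype ι] [DecidableEq ι] (i : ι) (u b e : ℝ) :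
    ∑ k, ((if i = k then u else 0) - (if i = k then b else 0) - (if i = k then e else 0)) ^ 2
      = (u - b - e) ^ 2 := by
  rw [Finset.sum_eq_single i] <;> simp +contextual [eq_comm]

theorem pred_div_eq {i m : ℕ} (h : i % m ≠ 0) : (i - 1) / m = i / m := by
  cases i with
  | zero => rfl
  | succ i =>
    rw [Nat.succ_div, if_neg (fun hd => h (Nat.mod_eq_zero_of_dvd hd))]
    rfl

theorem sum_fin_mul_mod_eq_zero {k m : ℕ} (hm : 0 < m) :
    ∑ i : Fin (k * m), (if (i : ℕ) % m = 0 then (1 : ℝ) else 0) = k := by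
  have : NeZero m := ⟨hm.ne'⟩
  rw [← finProdFinEquiv.sum_comp, Fintype.sum_prod_type]
  have : ∀ (q : Fin k) (r : Fin m),
      (if (finProdFinEquiv (q, r) : ℕ) % m = 0 then (1 : ℝ) else 0) = if r = 0 then 1 else 0 := by
    intro q r
    rw [finProdFinEquiv_apply_val, Nat.add_mul_mod_self_left, Nat.mod_eq_of_lt r.isLt]
    simp only [Fin.ext_iff, Fin.val_zero]
  simp only [this, Finset.sum_ite_eq', Finset.mem_univ, if_true, Finset.sum_const,
    Finset.card_univ, Fintype.card_fin, nsmul_eq_mul, mul_one]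

theorem sum_prod_add_sub_mul {A B : ℕ} (a : Fin A → ℝ) (b : Fin B → ℝ) :
    ∑ x : Fin A × Fin B, (a x.1 + b x.2 - a x.1 * b x.2)
      = B * ∑ i, a i + A * ∑ j, b j - (∑ i, a i) * ∑ j, b j := by
  rw [Finset.sum_mul_sum, Fintype.sum_prod_type]
  simp only [Finset.sum_add_distrib, Finset.sum_sub_distrib, Finset.sum_const, Finset.card_univ,
    Fintype.card_fin, nsmul_eq_mul, Finset.mul_sum]

theorem sum_fin_pred_le {K : ℕ} (g : Fin K → ℝ) (hg : ∀ i, 0 ≤ g i) :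
    ∑ i : Fin K, (if 1 ≤ (i : ℕ) then
        g ⟨(i : ℕ) - 1, lt_of_le_of_lt (Nat.sub_le _ _) i.isLt⟩ else 0) ≤ ∑ i, g i := by
  cases K with
  | zero => simp
  | succ K =>
    rw [Fin.sum_univ_succ, Fin.sum_univ_castSucc g]
    simp only [Fin.val_zero, Fin.val_succ, Nat.add_sub_cancel]
    simp only [show ¬ (1 ≤ 0) by omega, if_false, zero_add, Nat.le_add_left, if_true]
    exact le_add_of_nonneg_right (hg _)

/-- The preceding pixel in the first coordinate, truncated at the boundary. -/
def predFst {M N : ℕ} (x : Idx M N) : Idx M N :=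
  (⟨(x.1 : ℕ) - 1, lt_of_le_of_lt (Nat.sub_le _ _) x.1.isLt⟩, x.2)

/-- The preceding pixel in the second coordinate, truncated at the boundary. -/
def predSnd {M N : ℕ} (x : Idx M N) : Idx M N :=
  (x.1, ⟨(x.2 : ℕ) - 1, lt_of_le_of_lt (Nat.sub_le _ _) x.2.isLt⟩)

/-- The part of `divOp p x` that comes from the pixel `x` itself. -/
def outFlow {M N : ℕ} (p : Idx M N → ℝ × ℝ) (x : Idx M N) : ℝ :=
  (if (x.1 : ℕ) + 1 < M then (p x).1 else 0) + (if (x.2 : ℕ) + 1 < N then (p x).2 else 0)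

/-- The part of `divOp p x` that comes from the pixel `predFst x`, up to sign. -/
def inFlowFst {M N : ℕ} (p : Idx M N → ℝ × ℝ) (x : Idx M N) : ℝ :=
  if 1 ≤ (x.1 : ℕ) then (p (predFst x)).1 else 0

/-- The part of `divOp p x` that comes from the pixel `predSnd x`, up to sign. -/
def inFlowSnd {M N : ℕ} (p : Idx M N → ℝ × ℝ) (x : Idx M N) : ℝ :=
  if 1 ≤ (x.2 : ℕ) then (p (predSnd x)).2 else 0

section Flow

variable {M N : ℕ} (p : Idx M N → ℝ × ℝ) (x : Idx M N)

theorem divOp_eq_flow : divOp p x = outFlow p x - inFlowFst p x - inFlowSnd p x := by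
  simp only [divOp, outFlow, inFlowFst, inFlowSnd, predFst, predSnd]
  ring

theorem divOp_projk_eq_flow (S : Finset (Idx M N)) :
    divOp (projk S p) x = (if x ∈ S then outFlow p x else 0)
      - (if predFst x ∈ S then inFlowFst p x else 0)
      - (if predSnd x ∈ S then inFlowSnd p x else 0) := by
  rw [divOp_eq_flow]
  simp only [outFlow, inFlowFst, inFlowSnd, projk]
  split_ifs <;> simp

variable {p} {r : ℝ} (hp : ∀ x, (p x).1 ^ 2 + (p x).2 ^ 2 ≤ r)
include hp

theorem outFlow_sq_le : outFlow p x ^ 2 ≤ 2 * r := by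
  have h := hp x
  unfold outFlow
  split_ifs <;> nlinarith [sq_nonneg ((p x).1 - (p x).2), sq_nonneg (p x).1, sq_nonneg (p x).2]

theorem inFlowFst_sq_le : inFlowFst p x ^ 2 ≤ r := by
  have h := hp (predFst x)
  unfold inFlowFst
  split_ifs <;> nlinarith [sq_nonneg (p (predFst x)).1, sq_nonneg (p (predFst x)).2]

theorem inFlowSnd_sq_le : inFlowSnd p x ^ 2 ≤ r := by
  have h := hp (predSnd x)
  unfold inFlowSnd
  split_ifs <;> nlinarith [sq_nonneg (p (predSnd x)).1, sq_nonneg (p (predSnd x)).2]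

end Flow

theorem sum_inFlowFst_sq_le {M N : ℕ} (p : Idx M N → ℝ × ℝ) :
    ∑ x, inFlowFst p x ^ 2 ≤ ∑ x, (p x).1 ^ 2 := by
  rw [Fintype.sum_prod_type_right, Fintype.sum_prod_type_right]
  refine Finset.sum_le_sum fun j _ => ?_
  refine le_trans (le_of_eq ?_) (sum_fin_pred_le (fun i => (p (i, j)).1 ^ 2) fun i => sq_nonneg _)
  refine Finset.sum_congr rfl fun i _ => ?_
  simp only [inFlowFst, predFst]
  split_ifs <;> simp

theorem sum_inFlowSnd_sq_le {M N : ℕ} (p : Idx M N → ℝ × ℝ) :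
    ∑ x, inFlowSnd p x ^ 2 ≤ ∑ x, (p x).2 ^ 2 := by
  rw [Fintype.sum_prod_type, Fintype.sum_prod_type]
  refine Finset.sum_le_sum fun i _ => ?_
  refine le_trans (le_of_eq ?_) (sum_fin_pred_le (fun j => (p (i, j)).2 ^ 2) fun j => sq_nonneg _)
  refine Finset.sum_congr rfl fun j _ => ?_
  simp only [inFlowSnd, predSnd]
  split_ifs <;> simp

section Coloring

variable {M N Nc : ℕ} {S : Fin Nc → Finset (Idx M N)} {col : Idx M N → Fin Nc}
  (hcol : ∀ k x, x ∈ S k ↔ col x = k) (d : Idx M N → ℝ × ℝ)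
include hcol

theorem sum_divOp_projk_sq_le (x : Idx M N) :
    ∑ k, divOp (projk (S k) d) x ^ 2 ≤ divOp d x ^ 2
      + (outFlow d x ^ 2 + 2 * inFlowFst d x ^ 2 + 2 * inFlowSnd d x ^ 2) := by
  simp only [divOp_projk_eq_flow, divOp_eq_flow d x, hcol]
  exact sum_sq_colored_le _ _ _ _ _ _

theorem sum_divOp_projk_sq_eq {x : Idx M N} (h1 : col (predFst x) = col x)
    (h2 : col (predSnd x) = col x) :
    ∑ k, divOp (projk (S k) d) x ^ 2 = divOp d x ^ 2 := by
  simp only [divOp_projk_eq_flow, divOp_eq_flow d x, hcol, h1, h2]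
  exact sum_sq_single_color _ _ _ _

theorem sum_normVsq_divOp_projk_le_of_pixels {r : ℝ} (hd : ∀ x, (d x).1 ^ 2 + (d x).2 ^ 2 ≤ r) :
    ∑ k, normVsq (divOp (projk (S k) d)) ≤ normVsq (divOp d) + 4 * r * (M * N) := by
  have h1 := sum_inFlowFst_sq_le d
  have h2 := sum_inFlowSnd_sq_le d
  have h3 : ∑ x, ((d x).1 ^ 2 + (d x).2 ^ 2) ≤ ∑ _x : Idx M N, r :=
    Finset.sum_le_sum fun x _ => hd x
  have h4 : ∑ x, outFlow d x ^ 2 ≤ ∑ _x : Idx M N, 2 * r :=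
    Finset.sum_le_sum fun x _ => outFlow_sq_le x hd
  simp only [Finset.sum_add_distrib, Finset.sum_const, Finset.card_univ, Fintype.card_prod,
    Fintype.card_fin, nsmul_eq_mul, Nat.cast_mul] at h3 h4
  unfold normVsq
  rw [Finset.sum_comm]
  have h5 := Finset.sum_le_sum fun x (_ : x ∈ Finset.univ) => sum_divOp_projk_sq_le hcol d x
  simp only [Finset.sum_add_distrib, ← Finset.mul_sum] at h5
  linarith

end Coloring

theorem sum_normVsq_divOp_projk_le_of_blocks {Ms Ns m n Nc : ℕ} (hm : 0 < m) (hn : 0 < n)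
    {S : Fin Nc → Finset (Idx (Ms * m) (Ns * n))} {col : Idx (Ms * m) (Ns * n) → Fin Nc}
    (hcol : ∀ k x, x ∈ S k ↔ col x = k)
    (hunion : ∀ k, ∃ B : Finset (Fin Ms × Fin Ns), S k = B.biUnion (block m n))
    (d : Idx (Ms * m) (Ns * n) → ℝ × ℝ) {r : ℝ} (hd : ∀ x, (d x).1 ^ 2 + (d x).2 ^ 2 ≤ r) :
    ∑ k, normVsq (divOp (projk (S k) d)) ≤ normVsq (divOp d)
      + 6 * r * (Ms * (Ns * n) + Ms * m * Ns - Ms * Ns) := by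
  have hsame : ∀ x y : Idx (Ms * m) (Ns * n), (y.1 : ℕ) / m = (x.1 : ℕ) / m →
      (y.2 : ℕ) / n = (x.2 : ℕ) / n → col y = col x := by
    intro x y h1 h2
    rw [← hcol]
    obtain ⟨B, hB⟩ := hunion (col x)
    have hx : x ∈ S (col x) := (hcol _ _).2 rfl
    rw [hB] at hx ⊢
    simpa [block, h1, h2] using hx
  have hpix : ∀ x : Idx (Ms * m) (Ns * n), ∑ k, divOp (projk (S k) d) x ^ 2 ≤ divOp d x ^ 2
      + 6 * r * ((if (x.1 : ℕ) % m = 0 then 1 else 0) + (if (x.2 : ℕ) % n = 0 then 1 else 0)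
        - (if (x.1 : ℕ) % m = 0 then 1 else 0) * (if (x.2 : ℕ) % n = 0 then 1 else 0)) := by
    intro x
    by_cases hx : (x.1 : ℕ) % m ≠ 0 ∧ (x.2 : ℕ) % n ≠ 0
    · rw [sum_divOp_projk_sq_eq hcol d (hsame _ _ (pred_div_eq hx.1) rfl)
        (hsame _ _ rfl (pred_div_eq hx.2))]
      simp [hx.1, hx.2]
    · have h := sum_divOp_projk_sq_le hcol d x
      have h1 := outFlow_sq_le x hd
      have h2 := inFlowFst_sq_le x hd
      have h3 := inFlowSnd_sq_le x hd
      rw [not_and_or, not_not, not_not] at hx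
      rcases hx with hx | hx <;> simp only [hx, if_true] <;> linarith
  unfold normVsq
  rw [Finset.sum_comm]
  refine (Finset.sum_le_sum fun x _ => hpix x).trans (le_of_eq ?_)
  rw [Finset.sum_add_distrib, ← Finset.mul_sum,
    sum_prod_add_sub_mul (fun i : Fin (Ms * m) => if (i : ℕ) % m = 0 then (1 : ℝ) else 0)
      (fun j : Fin (Ns * n) => if (j : ℕ) % n = 0 then (1 : ℝ) else 0),
    sum_fin_mul_mod_eq_zero hm, sum_fin_mul_mod_eq_zero hn]
  push_cast
  ring

/-- `divOp` as a linear map into the Euclidean space of scalar images. -/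
def divLin (M N : ℕ) : (Idx M N → ℝ × ℝ) →ₗ[ℝ] EuclideanSpace ℝ (Idx M N) where
  toFun p := WithLp.toLp 2 (divOp p)
  map_add' p q := by
    ext x
    simp only [divOp, PiLp.add_apply, Pi.add_apply, Prod.fst_add, Prod.snd_add]
    split_ifs <;> ring
  map_smul' t p := by
    ext x
    simp only [divOp, PiLp.smul_apply, Pi.smul_apply, Prod.smul_fst, Prod.smul_snd, smul_eq_mul,
      RingHom.id_apply]
    split_ifs <;> ring

theorem norm_divLin_sq {M N : ℕ} (p : Idx M N → ℝ × ℝ) :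
    ‖divLin M N p‖ ^ 2 = normVsq (divOp p) := by
  simp [EuclideanSpace.real_norm_sq_eq, divLin, normVsq]

theorem F_eq_half_norm_sq {M N : ℕ} (α : ℝ) (f : Idx M N → ℝ) (p : Idx M N → ℝ × ℝ) :
    F α f p = 1 / 2 * ‖divLin M N p + WithLp.toLp 2 (fun x => α * f x)‖ ^ 2 := by
  simp [EuclideanSpace.real_norm_sq_eq, divLin, F, normVsq]

section Constraint

variable {M N : ℕ}

theorem mem_Cset_iff {p : Idx M N → ℝ × ℝ} :
    p ∈ Cset M N ↔ ∀ x, (p x).1 ^ 2 + (p x).2 ^ 2 ≤ 1 := by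
  simp [Cset, Real.sqrt_le_one]

theorem convex_Cset : Convex ℝ (Cset M N) := by
  intro p hp q hq a b ha hb hab
  rw [mem_Cset_iff] at *
  intro x
  have h1 := hp x
  have h2 := hq x
  obtain rfl : b = 1 - a := by linarith
  simp only [Pi.add_apply, Pi.smul_apply, Prod.fst_add, Prod.snd_add, Prod.smul_fst,
    Prod.smul_snd, smul_eq_mul]
  nlinarith [mul_nonneg (mul_nonneg ha hb) (add_nonneg (sq_nonneg ((p x).1 - (q x).1))
    (sq_nonneg ((p x).2 - (q x).2))), mul_le_mul_of_nonneg_left h1 ha,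
    mul_le_mul_of_nonneg_left h2 hb]

theorem sub_sq_add_sq_le_four {p q : Idx M N → ℝ × ℝ} (hp : p ∈ Cset M N) (hq : q ∈ Cset M N)
    (x : Idx M N) : ((p - q) x).1 ^ 2 + ((p - q) x).2 ^ 2 ≤ 4 := by
  rw [mem_Cset_iff] at *
  have h1 := hp x
  have h2 := hq x
  simp only [Pi.sub_apply, Prod.fst_sub, Prod.snd_sub]
  nlinarith [sq_nonneg ((p x).1 + (q x).1), sq_nonneg ((p x).2 + (q x).2)]

/-- The admissible fields that agree with `p` outside `S`. -/
def localCset (S : Finset (Idx M N)) (p : Idx M N → ℝ × ℝ) : Set (Idx M N → ℝ × ℝ) :=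
  {r | r ∈ Cset M N ∧ ∀ x ∉ S, r x = p x}

variable {S : Finset (Idx M N)} {p : Idx M N → ℝ × ℝ}

theorem convex_localCset : Convex ℝ (localCset S p) := by
  intro q hq r hr a b ha hb hab
  refine ⟨convex_Cset hq.1 hr.1 ha hb hab, fun x hx => ?_⟩
  rw [Pi.add_apply, Pi.smul_apply, Pi.smul_apply, hq.2 x hx, hr.2 x hx, ← add_smul, hab, one_smul]

theorem Ek_add_sub_projk_apply (t : {x // x ∈ S} → ℝ × ℝ) (x : Idx M N) :
    (Ek S t + (p - projk S p)) x = if h : x ∈ S then t ⟨x, h⟩ else p x := by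
  by_cases h : x ∈ S <;> simp [Ek, projk, h]

theorem Ek_add_sub_projk_mem {t : {x // x ∈ S} → ℝ × ℝ} (hp : p ∈ Cset M N) (ht : t ∈ Ck S) :
    Ek S t + (p - projk S p) ∈ localCset S p := by
  obtain ⟨r, hr, rfl⟩ := ht
  refine ⟨mem_Cset_iff.2 fun x => ?_, fun x hx => ?_⟩
  · rw [Ek_add_sub_projk_apply]
    split_ifs
    · exact mem_Cset_iff.1 hr x
    · exact mem_Cset_iff.1 hp x
  · rw [Ek_add_sub_projk_apply, dif_neg hx]

theorem F_le_of_mem_localCset {α : ℝ} {f : Idx M N → ℝ} {t : {x // x ∈ S} → ℝ × ℝ}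
    (hmin : ∀ rk ∈ Ck S, Fk α f S t p ≤ Fk α f S rk p) {r : Idx M N → ℝ × ℝ}
    (hr : r ∈ localCset S p) : F α f (Ek S t + (p - projk S p)) ≤ F α f r := by
  have h := hmin (Rk S r) ⟨r, hr.1, rfl⟩
  have hrr : Ek S (Rk S r) + (p - projk S p) = r := by
    funext x
    rw [Ek_add_sub_projk_apply]
    split_ifs with hx
    · rfl
    · exact (hr.2 x hx).symm
  simpa only [Fk, hrr] using h

theorem add_projk_sub_mem_localCset {z : Idx M N → ℝ × ℝ} (hp : p ∈ Cset M N)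
    (hz : z ∈ Cset M N) : p + projk S (z - p) ∈ localCset S p := by
  refine ⟨mem_Cset_iff.2 fun x => ?_, fun x hx => by simp [projk, hx]⟩
  by_cases hx : x ∈ S
  · simpa [projk, hx] using mem_Cset_iff.1 hz x
  · simpa [projk, hx] using mem_Cset_iff.1 hp x

end Constraint

section ColoredProjection

variable {M N Nc : ℕ} {S : Fin Nc → Finset (Idx M N)} {col : Idx M N → Fin Nc}
  (hcol : ∀ k x, x ∈ S k ↔ col x = k)
include hcol

theorem sum_projk (d : Idx M N → ℝ × ℝ) : ∑ k, projk (S k) d = d := by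
  funext x
  simp [Finset.sum_apply, projk, hcol]

theorem projk_add_smul_sum {w : Fin Nc → Idx M N → ℝ × ℝ} (hw : ∀ k, ∀ x ∉ S k, w k x = 0)
    (d : Idx M N → ℝ × ℝ) (a : ℝ) (k : Fin Nc) :
    projk (S k) (d + a • ∑ l, w l) = projk (S k) d + a • w k := by
  funext x
  by_cases hx : x ∈ S k
  · have hsum : ∑ l, w l x = w k x := Finset.sum_eq_single k (fun l _ hl => hw l x fun hxl =>
      hl (((hcol l x).1 hxl).symm.trans ((hcol k x).1 hx))) (by simp)
    simp [projk, hx, hsum]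
  · simp [projk, hx, hw k x hx]

end ColoredProjection

/-- The relaxed block Jacobi energies decrease at rate `1 / K`, with a constant given by the initial
distance and energy gap. -/
theorem relaxed_jacobi_energy_le {M N Nc : ℕ} (hNc : 0 < Nc) {α : ℝ} {f : Idx M N → ℝ}
    {S : Fin Nc → Finset (Idx M N)} {col : Idx M N → Fin Nc} (hcol : ∀ k x, x ∈ S k ↔ col x = k)
    {p : ℕ → Idx M N → ℝ × ℝ} (hp0 : p 0 ∈ Cset M N)
    {s : ∀ _ : ℕ, ∀ k : Fin Nc, {x // x ∈ S k} → ℝ × ℝ} (hs : ∀ i k, s i k ∈ Ck (S k))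
    (hmin : ∀ i k, ∀ rk ∈ Ck (S k), Fk α f (S k) (s i k) (p i) ≤ Fk α f (S k) rk (p i))
    (hrec : ∀ i, p (i + 1) =
      (1 / (Nc : ℝ)) • ∑ k, (Ek (S k) (s i k) + (p i - projk (S k) (p i))))
    {pstar : Idx M N → ℝ × ℝ} (hpstar : pstar ∈ Cset M N)
    (hstar : ∀ r ∈ Cset M N, F α f pstar ≤ F α f r) (K : ℕ) :
    1 / (Nc : ℝ) * K * (F α f (p K) - F α f pstar)
      ≤ 3 / 4 * (Ddist S (p 0) pstar + (F α f (p 0) - F α f pstar)) := by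
  have hNc' : (0 : ℝ) < Nc := Nat.cast_pos.2 hNc
  have hNc1 : (1 : ℝ) ≤ Nc := Nat.one_le_cast.2 hNc
  obtain ⟨a, ha_def⟩ : ∃ a : ℝ, a = 1 / Nc := ⟨_, rfl⟩
  have ha : 0 < a := by rw [ha_def]; positivity
  have ha1 : a ≤ 1 := by rw [ha_def, div_le_one hNc']; exact hNc1
  have haNc : a * Nc = 1 := by rw [ha_def]; field_simp
  have hcard : a * Fintype.card (Fin Nc) ≤ 1 := by rw [Fintype.card_fin]; exact haNc.le
  set q : ℕ → Fin Nc → Idx M N → ℝ × ℝ :=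
    fun i k => Ek (S k) (s i k) + (p i - projk (S k) (p i))
  set L := divLin M N
  set c : EuclideanSpace ℝ (Idx M N) := WithLp.toLp 2 (fun x => α * f x)
  have hF : ∀ r, F α f r = 1 / 2 * ‖L r + c‖ ^ 2 := F_eq_half_norm_sq α f
  have hmem : ∀ i, p i ∈ Cset M N := by
    intro i
    induction i with
    | zero => exact hp0
    | succ i ih =>
      rw [hrec, ← ha_def, Finset.smul_sum]
      exact convex_Cset.sum_mem (fun _ _ => ha.le)
        (by simp [mul_comm, haNc]) fun k _ => (Ek_add_sub_projk_mem ih (hs i k)).1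
  have hqmem : ∀ i k, q i k ∈ localCset (S k) (p i) := fun i k =>
    Ek_add_sub_projk_mem (hmem i) (hs i k)
  have hstep : ∀ i, p (i + 1) = p i + a • ∑ k, (q i k - p i) := by
    intro i
    rw [hrec, ← ha_def, Finset.sum_sub_distrib, smul_sub, Finset.sum_const, Finset.card_univ,
      Fintype.card_fin, ← Nat.cast_smul_eq_nsmul ℝ, smul_smul, haNc, one_smul, add_sub_cancel]
  have hvi : ∀ i k, ∀ z ∈ localCset (S k) (p i), 0 ≤ inner ℝ (L (q i k) + c) (L (z - q i k)) := by
    intro i k z hz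
    refine inner_nonneg_of_isMinOn_half_norm_sq convex_localCset L c (hqmem i k) hz fun r hr => ?_
    rw [← hF, ← hF]
    exact F_le_of_mem_localCset (hmin i k) hr
  have hh : ∀ i k, L (q i k) + c = L (p i) + c + L (q i k - p i) := fun i k => by
    rw [map_sub]; abel
  have hv : ∀ i k, inner ℝ (L (p i) + c + L (q i k - p i)) (L (q i k - p i)) ≤ 0 := by
    intro i k
    have h := hvi i k (p i) ⟨hmem i, fun _ _ => rfl⟩
    rw [← neg_sub, map_neg, inner_neg_right] at h
    rw [← hh]
    linarith
  have hev : ∀ i k, inner ℝ (L (p i) + c + L (q i k - p i))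
      (L (projk (S k) (p i - pstar)) + L (q i k - p i)) ≤ 0 := by
    intro i k
    have h := hvi i k _ (add_projk_sub_mem_localCset (hmem i) hpstar)
    have heq : p i + projk (S k) (pstar - p i) - q i k
        = -(projk (S k) (p i - pstar) + (q i k - p i)) := by
      have : projk (S k) (pstar - p i) = -projk (S k) (p i - pstar) := by
        funext x
        by_cases hx : x ∈ S k <;> simp [projk, hx]
      rw [this]
      abel
    rw [heq, map_neg, inner_neg_right, map_add L (projk (S k) (p i - pstar))] at h
    rw [← hh]
    linarith
  have hL : ∀ i, L (p (i + 1)) + c = L (p i) + c + a • ∑ k, L (q i k - p i) := by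
    intro i
    rw [hstep, map_add, map_smul, map_sum]
    abel
  have he : ∀ i k, L (projk (S k) (p (i + 1) - pstar))
      = L (projk (S k) (p i - pstar)) + a • L (q i k - p i) := by
    intro i k
    rw [hstep, add_sub_right_comm, projk_add_smul_sum hcol, map_add, map_smul]
    intro k x hx
    rw [Pi.sub_apply, (hqmem i k).2 x hx, sub_self]
  have hLstar : ∀ i, L pstar + c = L (p i) + c - ∑ k, L (projk (S k) (p i - pstar)) := by
    intro i
    rw [← map_sum, sum_projk hcol, map_sub]
    abel
  have hD : Ddist S (p 0) pstar = 1 / 2 * ∑ k, ‖L (projk (S k) (p 0 - pstar))‖ ^ 2 := by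
    simp only [Ddist, Finset.mul_sum, norm_divLin_sq, L]
  rw [← ha_def, hD]
  refine mul_le_three_quarters_of_descent ha ha1 (fun i => F α f (p i) - F α f pstar)
    (fun i => 1 / 2 * ∑ k, ‖L (projk (S k) (p i - pstar))‖ ^ 2)
    (fun i => 1 / 2 * ∑ k, ‖L (q i k - p i)‖ ^ 2)
    (fun i => sub_nonneg.2 (hstar _ (hmem i))) (fun i => by positivity) (fun i => by positivity)
    (fun i => ?_) (fun i => ?_) (fun i => ?_) K
  · simp only [hF, he i, hL i]
    rw [hLstar i]
    exact relaxed_step_distance_add_energy_le ha.le ha1 hcard _ _ _ (hev i)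
  · have := half_norm_sq_relaxed_step_le ha.le hcard _ _ (hv i)
    simp only [hF, hL i]
    linarith
  · simp only [he i]
    exact sq_sqrt_sub_le_relaxed_step_distance ha.le _ _

theorem half_normVsq_divOp_sub_le {M N : ℕ} {α : ℝ} {f : Idx M N → ℝ} {p pstar : Idx M N → ℝ × ℝ}
    (hp : p ∈ Cset M N) (hpstar : pstar ∈ Cset M N)
    (hstar : ∀ r ∈ Cset M N, F α f pstar ≤ F α f r) :
    1 / 2 * normVsq (divOp (p - pstar)) ≤ F α f p - F α f pstar := by
  have hvi := inner_nonneg_of_isMinOn_half_norm_sq convex_Cset (divLin M N)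
    (WithLp.toLp 2 (fun x => α * f x)) hpstar hp fun r hr => by
      rw [← F_eq_half_norm_sq, ← F_eq_half_norm_sq]; exact hstar r hr
  have hsub : divLin M N p + WithLp.toLp 2 (fun x => α * f x)
      = divLin M N pstar + WithLp.toLp 2 (fun x => α * f x)
        + (1 : ℝ) • divLin M N (p - pstar) := by
    rw [one_smul, map_sub]; abel
  rw [F_eq_half_norm_sq, F_eq_half_norm_sq, hsub, half_norm_add_smul_sq, norm_divLin_sq]
  linarith

theorem F_le_of_single_color {M N : ℕ} {α : ℝ} {f : Idx M N → ℝ} {S : Finset (Idx M N)}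
    (hS : ∀ x, x ∈ S) {p pstar : Idx M N → ℝ × ℝ} (hpstar : pstar ∈ Cset M N)
    {t : {x // x ∈ S} → ℝ × ℝ} (hmin : ∀ rk ∈ Ck S, Fk α f S t p ≤ Fk α f S rk p) :
    F α f (Ek S t + (p - projk S p)) ≤ F α f pstar :=
  F_le_of_mem_localCset hmin ⟨hpstar, fun x hx => absurd (hS x) hx⟩

theorem decomposition_constant_bound {Ms Ns m n : ℕ} (hm : 0 < m) (hn : 0 < n)
    {Nc : ℕ} {S : Fin Nc → Finset (Idx (Ms * m) (Ns * n))} {col : Idx (Ms * m) (Ns * n) → Fin Nc}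
    (hcol : ∀ k x, x ∈ S k ↔ col x = k)
    (hunion : ∀ k, ∃ B : Finset (Fin Ms × Fin Ns), S k = B.biUnion (block m n))
    {p pstar : Idx (Ms * m) (Ns * n) → ℝ × ℝ} (hp : p ∈ Cset (Ms * m) (Ns * n))
    (hpstar : pstar ∈ Cset (Ms * m) (Ns * n)) :
    3 / 4 * Ddist S p pstar ≤ 3 / 4 * (1 / 2 * normVsq (divOp (p - pstar)))
      + 2 * (7 * (((Ms * m : ℕ) : ℝ) * Ns + Ms * ((Ns * n : ℕ) : ℝ) - 11 / 7 * (Ms * Ns))) := by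
  have hd := sub_sq_add_sq_le_four hp hpstar
  have hD : Ddist S p pstar = 1 / 2 * ∑ k, normVsq (divOp (projk (S k) (p - pstar))) := by
    rw [Ddist, Finset.mul_sum]
  have hMN : (0 : ℝ) ≤ Ms * Ns := by positivity
  rw [hD]
  by_cases h1 : m = 1 ∧ n = 1
  · obtain ⟨rfl, rfl⟩ := h1
    have h := sum_normVsq_divOp_projk_le_of_pixels hcol (p - pstar) hd
    push_cast at h ⊢
    linarith
  · have h := sum_normVsq_divOp_projk_le_of_blocks hm hn hcol hunion (p - pstar) hd
    have h3 : (3 : ℝ) ≤ m + n := by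
      have : 3 ≤ m + n := by omega
      exact_mod_cast this
    push_cast at h ⊢
    nlinarith [mul_le_mul_of_nonneg_left h3 hMN]

theorem relaxed_jacobi_explicit_rate (M N Ms Ns m n : ℕ) (hm : 0 < m) (hn : 0 < n)
    (hM : M = Ms * m) (hN : N = Ns * n)
    (α : ℝ) (hα : 0 < α) (f : Idx M N → ℝ)
    (Nc : ℕ) (S : Fin Nc → Finset (Idx M N))
    (hdisj : ∀ k l, k ≠ l → Disjoint (S k) (S l))
    (hcover : ∀ x : Idx M N, ∃ k, x ∈ S k)
    (hunion : ∀ k, ∃ B : Finset (Fin Ms × Fin Ns), S k = B.biUnion (block m n))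
    (p : ℕ → Idx M N → ℝ × ℝ) (hp0 : p 0 ∈ Cset M N)
    (s : ∀ _ : ℕ, ∀ k : Fin Nc, {x // x ∈ S k} → ℝ × ℝ)
    (hs : ∀ n k, s n k ∈ Ck (S k))
    (hmin : ∀ n k, ∀ rk ∈ Ck (S k),
      Fk α f (S k) (s n k) (p n) ≤ Fk α f (S k) rk (p n))
    (hrec : ∀ n, p (n + 1) =
      (1 / (Nc : ℝ)) • ∑ k, (Ek (S k) (s n k) + (p n - projk (S k) (p n))))
    (pstar : Idx M N → ℝ × ℝ) (hpstar : pstar ∈ Cset M N)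
    (hstar : ∀ r ∈ Cset M N, F α f pstar ≤ F α f r)
    : ∀ n : ℕ, 1 ≤ n →
      F α f (p n) - F α f pstar ≤
        ((Nc : ℝ) / (n : ℝ)) *
          ((2 - 1 / (Nc : ℝ)) * (F α f (p 0) - F α f pstar)
            + 2 * (7 * ((M : ℝ) * (Ns : ℝ) + (Ms : ℝ) * (N : ℝ) - (11 / 7) * ((Ms : ℝ) * (Ns : ℝ))))) := by
  subst hM hN
  have hpos : 0 ≤ F α f (p 0) - F α f pstar := sub_nonneg.2 (hstar _ hp0)
  have hconst : (0 : ℝ) ≤ ((Ms * m : ℕ) : ℝ) * Ns + Ms * ((Ns * n : ℕ) : ℝ)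
      - 11 / 7 * (Ms * Ns) := by
    have h1 : (1 : ℝ) ≤ m := Nat.one_le_cast.2 hm
    have h2 : (1 : ℝ) ≤ n := Nat.one_le_cast.2 hn
    have h3 : (0 : ℝ) ≤ Ms * Ns := by positivity
    push_cast
    nlinarith [mul_le_mul_of_nonneg_left h1 h3, mul_le_mul_of_nonneg_left h2 h3]
  intro K hK
  have hK' : (0 : ℝ) < K := Nat.cast_pos.2 hK
  obtain rfl | rfl | hNc : Nc = 0 ∨ Nc = 1 ∨ 2 ≤ Nc := by omega
  · have : IsEmpty (Idx (Ms * m) (Ns * n)) := ⟨fun x => (hcover x).choose.elim0⟩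
    rw [Subsingleton.elim (p K) pstar]
    simp
  · have hS : ∀ x, x ∈ S 0 := fun x => by
      obtain ⟨k, hk⟩ := hcover x
      rwa [Subsingleton.elim k 0] at hk
    have hle : F α f (p K) ≤ F α f pstar := by
      obtain ⟨i, rfl⟩ := Nat.exists_eq_add_of_le' hK
      rw [hrec]
      simpa using F_le_of_single_color hS hpstar (hmin i 0)
    refine (sub_nonpos.2 hle).trans (mul_nonneg (by positivity) ?_)
    norm_num at hpos hconst ⊢
    linarith
  · choose col hmem using hcover
    have hcol : ∀ k x, x ∈ S k ↔ col x = k := fun k x =>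
      ⟨fun hx => by_contra fun hne => Finset.disjoint_left.1 (hdisj _ _ hne) (hmem x) hx,
        fun h => h ▸ hmem x⟩
    have hNc2 : (2 : ℝ) ≤ Nc := by exact_mod_cast hNc
    have hrate := relaxed_jacobi_energy_le (by omega) hcol hp0 hs hmin hrec hpstar hstar K
    have hD := decomposition_constant_bound hm hn hcol hunion hp0 hpstar
    have hB := half_normVsq_divOp_sub_le hp0 hpstar hstar
    have hinv : 1 / (Nc : ℝ) ≤ 1 / 2 := one_div_le_one_div_of_le (by norm_num) hNc2
    have hfin : 1 / (Nc : ℝ) * K * (F α f (p K) - F α f pstar)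
        ≤ (2 - 1 / (Nc : ℝ)) * (F α f (p 0) - F α f pstar)
          + 2 * (7 * (((Ms * m : ℕ) : ℝ) * Ns + Ms * ((Ns * n : ℕ) : ℝ)
            - 11 / 7 * (Ms * Ns))) := by
      nlinarith [mul_le_mul_of_nonneg_right hinv hpos]
    have hNc0 : (0 : ℝ) < Nc := by linarith
    calc F α f (p K) - F α f pstar
        = Nc / K * (1 / (Nc : ℝ) * K * (F α f (p K) - F α f pstar)) := by field_simp
      _ ≤ _ := mul_le_mul_of_nonneg_left hfin (by positivity)
end

section
/- The pre-relaxed block Jacobi step is a proximal forward-backward step: for q ∈ C, if for each k the element t_k ∈ C_k minimizes p_k ↦ F_k(N_c p_k − (N_c − 1) R_k q; q) over C_k, then Σ_{k=1}^{N_c} R_k* t_k is a minimizer over C of p ↦ F(q) + ⟨∇F(q), p − q⟩ + N_c D(p, q). -/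
open Finset

theorem sum_fin_shift {M : ℕ} (u a : Fin M → ℝ) :
    (∑ i : Fin M, u i * (if 1 ≤ (i : ℕ) then
        a ⟨(i : ℕ) - 1, lt_of_le_of_lt (Nat.sub_le _ _) i.isLt⟩ else 0))
      = ∑ i : Fin M, (if h : (i : ℕ) + 1 < M then u ⟨(i : ℕ) + 1, h⟩ else 0) * a i := by
  cases M with
  | zero => simp
  | succ n =>
    rw [Fin.sum_univ_succ, Fin.sum_univ_castSucc]
    simp only [Fin.val_zero, Fin.val_succ, Fin.val_castSucc, Fin.val_last, lt_irrefl,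
      dite_false, zero_mul, add_zero]
    simp
    rfl

/-- One-dimensional summation by parts. -/
theorem sum_mul_backwardDiff {M : ℕ} (u a : Fin M → ℝ) :
    (∑ i : Fin M, u i * ((if (i : ℕ) + 1 < M then a i else 0) - (if 1 ≤ (i : ℕ) then
        a ⟨(i : ℕ) - 1, lt_of_le_of_lt (Nat.sub_le _ _) i.isLt⟩ else 0)))
      = - ∑ i : Fin M,
        (if h : (i : ℕ) + 1 < M then u ⟨(i : ℕ) + 1, h⟩ - u i else 0) * a i := by
  simp only [mul_sub, Finset.sum_sub_distrib]
  rw [sum_fin_shift, ← Finset.sum_sub_distrib, ← Finset.sum_neg_distrib]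
  refine Finset.sum_congr rfl fun i _ => ?_
  split_ifs <;> ring

/-- The divergence is the negative adjoint of the gradient. -/
theorem innerV_divOp {M N : ℕ} (u : Idx M N → ℝ) (p : Idx M N → ℝ × ℝ) :
    innerV u (divOp p) = - innerW (gradOp u) p := by
  simp only [innerV, innerW, divOp, gradOp, mul_add, Finset.sum_add_distrib, neg_add]
  congr 1
  · rw [Fintype.sum_prod_type_right, Fintype.sum_prod_type_right, ← Finset.sum_neg_distrib]
    exact Finset.sum_congr rfl fun j _ =>
      sum_mul_backwardDiff (fun i => u (i, j)) (fun i => (p (i, j)).1)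
  · rw [Fintype.sum_prod_type, Fintype.sum_prod_type, ← Finset.sum_neg_distrib]
    exact Finset.sum_congr rfl fun i _ =>
      sum_mul_backwardDiff (fun j => u (i, j)) (fun j => (p (i, j)).2)

theorem innerV_divOp_eq_innerW_gradF {M N : ℕ} (α : ℝ) (f : Idx M N → ℝ)
    (q p : Idx M N → ℝ × ℝ) :
    innerV (fun x => divOp q x + α * f x) (divOp p) = innerW (gradF α f q) p := by
  rw [innerV_divOp]
  simp only [innerW, gradF, ← Finset.sum_neg_distrib, Prod.fst_neg, Prod.snd_neg]
  exact Finset.sum_congr rfl fun x _ => by ring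

theorem divOp_add_smul {M N : ℕ} (c : ℝ) (q p : Idx M N → ℝ × ℝ) (x : Idx M N) :
    divOp (q + c • p) x = divOp q x + c * divOp p x := by
  simp only [divOp, Pi.add_apply, Pi.smul_apply, Prod.fst_add, Prod.snd_add, Prod.smul_fst,
    Prod.smul_snd, smul_eq_mul]
  split_ifs <;> ring

/-- Second-order expansion of the quadratic energy. -/
theorem F_add_smul {M N : ℕ} (α : ℝ) (f : Idx M N → ℝ) (c : ℝ) (q p : Idx M N → ℝ × ℝ) :
    F α f (q + c • p)
      = F α f q + c * (innerW (gradF α f q) p + c * ((1 / 2) * normVsq (divOp p))) := by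
  rw [← innerV_divOp_eq_innerW_gradF]
  simp only [F, normVsq, innerV, divOp_add_smul, Finset.mul_sum, ← Finset.sum_add_distrib]
  exact Finset.sum_congr rfl fun x _ => by ring

theorem Fk_relaxed {M N : ℕ} (α : ℝ) (f : Idx M N → ℝ) (S : Finset (Idx M N)) (c : ℝ)
    (r q : Idx M N → ℝ × ℝ) :
    Fk α f S (c • Rk S r - (c - 1) • Rk S q) q
      = F α f q + c * (innerW (gradF α f q) (projk S (r - q))
          + c * ((1 / 2) * normVsq (divOp (projk S (r - q))))) := by
  rw [← F_add_smul, Fk]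
  congr 1
  funext x
  by_cases h : x ∈ S
  · simp [Ek, projk, Rk, h]
    module
  · simp [Ek, projk, h]

theorem sum_innerW_projk {M N Nc : ℕ} {S : Fin Nc → Finset (Idx M N)}
    (hdisj : ∀ k l, k ≠ l → Disjoint (S k) (S l)) (hcover : ∀ x : Idx M N, ∃ k, x ∈ S k)
    (g p : Idx M N → ℝ × ℝ) : ∑ k, innerW g (projk (S k) p) = innerW g p := by
  simp only [innerW]
  rw [Finset.sum_comm]
  refine Finset.sum_congr rfl fun x _ => ?_
  obtain ⟨k, hk⟩ := hcover x
  rw [Finset.sum_eq_single k]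
  · simp [projk, hk]
  · intro l _ hl
    simp [projk, Finset.disjoint_left.mp (hdisj k l hl.symm) hk]
  · simp

theorem sum_Ek_apply {M N Nc : ℕ} {S : Fin Nc → Finset (Idx M N)}
    (hdisj : ∀ k l, k ≠ l → Disjoint (S k) (S l))
    (t : ∀ k : Fin Nc, {x // x ∈ S k} → ℝ × ℝ) {k : Fin Nc} {x : Idx M N} (hx : x ∈ S k) :
    (∑ l, Ek (S l) (t l)) x = t k ⟨x, hx⟩ := by
  rw [Finset.sum_apply, Finset.sum_eq_single k]
  · simp [Ek, hx]
  · intro l _ hl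
    simp [Ek, Finset.disjoint_left.mp (hdisj k l hl.symm) hx]
  · simp

theorem prerelaxed_step_is_proximal (M N : ℕ) (α : ℝ) (hα : 0 < α) (f : Idx M N → ℝ)
    (Nc : ℕ) (S : Fin Nc → Finset (Idx M N))
    (hdisj : ∀ k l, k ≠ l → Disjoint (S k) (S l))
    (hcover : ∀ x : Idx M N, ∃ k, x ∈ S k)
    (q : Idx M N → ℝ × ℝ) (hq : q ∈ Cset M N)
    (t : ∀ k : Fin Nc, {x // x ∈ S k} → ℝ × ℝ)
    (ht : ∀ k, t k ∈ Ck (S k))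
    (hmin : ∀ k, ∀ rk ∈ Ck (S k),
      Fk α f (S k) ((Nc : ℝ) • t k - ((Nc : ℝ) - 1) • Rk (S k) q) q
        ≤ Fk α f (S k) ((Nc : ℝ) • rk - ((Nc : ℝ) - 1) • Rk (S k) q) q) :
    (∑ k, Ek (S k) (t k)) ∈ Cset M N ∧
      ∀ r ∈ Cset M N,
        F α f q + innerW (gradF α f q) ((∑ k, Ek (S k) (t k)) - q)
            + (Nc : ℝ) * Ddist S (∑ k, Ek (S k) (t k)) q
          ≤ F α f q + innerW (gradF α f q) (r - q) + (Nc : ℝ) * Ddist S r q := by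
  set T := ∑ k, Ek (S k) (t k)
  have hRT : ∀ k, Rk (S k) T = t k := fun k => funext fun x => sum_Ek_apply hdisj t x.2
  refine ⟨fun x => ?_, fun r hr => ?_⟩
  · obtain ⟨k, hk⟩ := hcover x
    obtain ⟨p, hp, hpt⟩ := ht k
    rw [show T x = t k ⟨x, hk⟩ from sum_Ek_apply hdisj t hk, ← hpt]
    exact hp x
  · have hblock : ∀ k, innerW (gradF α f q) (projk (S k) (T - q))
          + (Nc : ℝ) * ((1 / 2) * normVsq (divOp (projk (S k) (T - q))))
        ≤ innerW (gradF α f q) (projk (S k) (r - q))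
          + (Nc : ℝ) * ((1 / 2) * normVsq (divOp (projk (S k) (r - q)))) := by
      intro k
      have hNc : (0 : ℝ) < Nc := Nat.cast_pos.mpr k.pos
      have h := hmin k (Rk (S k) r) ⟨r, hr, rfl⟩
      rw [← hRT k, Fk_relaxed, Fk_relaxed] at h
      exact le_of_mul_le_mul_left (le_of_add_le_add_left h) hNc
    have hsum := Finset.sum_le_sum fun k (_ : k ∈ Finset.univ) => hblock k
    simp only [Finset.sum_add_distrib, sum_innerW_projk hdisj hcover, ← Finset.mul_sum] at hsum
    simp only [Ddist, ← Finset.mul_sum]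
    linarith
end
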